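/- Under Assumption 2.3 (with z_{v₀,e₀} and z_{v₁,e₀} finite), for every γ ∈ ℝ one has the key estimate log Z_{v₀,v₁,e₀} ≤ E_{Π^{γφ}}[H] + E_{Π^{γφ}}[ log( dΠ^{γφ}/dℙ_{v₀,v₁,e₀} ) ], where H(x) := (1/4)·log(x_{v₁}/x_{v₀}). -/

import Mathlib

open MeasureTheory
open scoped ENNReal Classical

namespace ERRWGraph

noncomputable section

variable {V : Type*} [Fintype V] [DecidableEq V]

/-- The measure `dx/x` on `(0,∞)`, i.e. Lebesgue measure on a logarithmic scale. -/
def logMeasure : Measure ℝ :=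
  (volume.restrict (Set.Ioi (0 : ℝ))).withDensity fun x => ENNReal.ofReal (1 / x)

variable (G : SimpleGraph V) [Fintype G.edgeSet]

/-- The set `Ω_{e₀}` of strictly positive edge weights normalized at the reference
edge `e₀`. -/
def Omega (e₀ : G.edgeSet) : Set (G.edgeSet → ℝ) :=
  {x | (∀ e, 0 < x e) ∧ x e₀ = 1}

/-- The reference measure `ρ_{e₀} = δ₁(dx_{e₀}) ∏_{e ≠ e₀} dx_e/x_e`, realized as a
measure on `(0,∞)^E ⊆ ℝ^E` concentrated on `Ω_{e₀}`. -/
def rho (e₀ : G.edgeSet) : Measure (G.edgeSet → ℝ) :=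
  Measure.pi fun e => if e = e₀ then Measure.dirac 1 else logMeasure

/-- Vertex weight `x_v = ∑_{e ∋ v} x_e`. -/
def vwt (x : G.edgeSet → ℝ) (v : V) : ℝ :=
  ∑ e : G.edgeSet, if v ∈ (e : Sym2 V) then x e else 0

/-- Vertex weight `a_v = ∑_{e ∋ v} a_e` of the initial weights `a : Sym2 V → ℝ`. -/
def avwt (a : Sym2 V → ℝ) (v : V) : ℝ :=
  ∑ e : G.edgeSet, if v ∈ (e : Sym2 V) then a (e : Sym2 V) else 0

/-- A set `T` of edges of `G` is a spanning tree iff the graph with edge set `T`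
is a tree (i.e. a maximal connected acyclic subgraph of `G`). -/
def IsSpanningTree (T : Finset G.edgeSet) : Prop :=
  (SimpleGraph.fromEdgeSet (Subtype.val '' (T : Set G.edgeSet))).IsTree

/-- `∑_{T ∈ 𝒯} ∏_{e ∈ T} x_e`, the sum over spanning trees of `G`. -/
def treeSum (x : G.edgeSet → ℝ) : ℝ :=
  ∑ T : Finset G.edgeSet, if IsSpanningTree G T then (∏ e ∈ T, x e) else 0

/-- The function `Φ_{v₀,a}` from the Coppersmith–Diaconis description of the
mixing measure. -/
def Phi (a : Sym2 V → ℝ) (v₀ : V) (x : G.edgeSet → ℝ) : ℝ :=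
  (∏ e : G.edgeSet, x e ^ a (e : Sym2 V)) * vwt G x v₀ ^ (-avwt G a v₀ / 2) *
    (∏ v ∈ Finset.univ.erase v₀, vwt G x v ^ (-(avwt G a v + 1) / 2)) *
    Real.sqrt (treeSum G x)

/-- The normalizing constant `z_{v₀,e₀} = ∫ Φ_{v₀,a} dρ_{e₀}`. -/
def z (a : Sym2 V → ℝ) (v₀ : V) (e₀ : G.edgeSet) : ℝ≥0∞ :=
  ∫⁻ x, ENNReal.ofReal (Phi G a v₀ x) ∂rho G e₀

/-- The mixing measure `ℚ_{v₀,e₀}`, with density `Φ_{v₀,a}/z_{v₀,e₀}` w.r.t. `ρ_{e₀}`. -/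
def Qm (a : Sym2 V → ℝ) (v₀ : V) (e₀ : G.edgeSet) : Measure (G.edgeSet → ℝ) :=
  (z G a v₀ e₀)⁻¹ • (rho G e₀).withDensity fun x => ENNReal.ofReal (Phi G a v₀ x)

/-- The density `((Φ_{v₀,a}/z_{v₀,e₀})·(Φ_{v₁,a}/z_{v₁,e₀}))^{1/2}` of the
interpolated measure. -/
def interpDens (a : Sym2 V → ℝ) (v₀ v₁ : V) (e₀ : G.edgeSet) (x : G.edgeSet → ℝ) : ℝ≥0∞ :=
  (ENNReal.ofReal (Phi G a v₀ x) / z G a v₀ e₀ *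
    (ENNReal.ofReal (Phi G a v₁ x) / z G a v₁ e₀)) ^ (1 / 2 : ℝ)

/-- The normalizing constant `Z_{v₀,v₁,e₀}` of the interpolated measure. -/
def Zc (a : Sym2 V → ℝ) (v₀ v₁ : V) (e₀ : G.edgeSet) : ℝ≥0∞ :=
  ∫⁻ x, interpDens G a v₀ v₁ e₀ x ∂rho G e₀

/-- The interpolated measure `ℙ_{v₀,v₁,e₀}`. -/
def Pm (a : Sym2 V → ℝ) (v₀ v₁ : V) (e₀ : G.edgeSet) : Measure (G.edgeSet → ℝ) :=
  (Zc G a v₀ v₁ e₀)⁻¹ • (rho G e₀).withDensity (interpDens G a v₀ v₁ e₀)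

/-- `f` is an automorphism of the weighted graph `(G,a)`. -/
def IsAut (a : Sym2 V → ℝ) (f : V → V) : Prop :=
  Function.Bijective f ∧ (∀ u v : V, G.Adj (f u) (f v) ↔ G.Adj u v) ∧
    ∀ u v : V, G.Adj u v → a s(f u, f v) = a s(u, v)

/-- Assumption 2.3 of the paper. -/
def Assumption23 (a φ : Sym2 V → ℝ) (v₀ v₁ : V) (e₀ : G.edgeSet) : Prop :=
  v₀ ≠ v₁ ∧ ¬G.Adj v₀ v₁ ∧ v₀ ∈ (e₀ : Sym2 V) ∧
    (∃ f : V → V, IsAut G a f ∧ f v₀ = v₁ ∧ f v₁ = v₀) ∧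
    (∀ e : G.edgeSet, φ (e : Sym2 V) ∈ Set.Icc (0 : ℝ) 1) ∧
    (∀ e : G.edgeSet, v₀ ∈ (e : Sym2 V) → φ (e : Sym2 V) = 0) ∧
    (∀ e : G.edgeSet, v₁ ∈ (e : Sym2 V) → φ (e : Sym2 V) = 1)

/-- `max_{e,e' ∋ v} (φ(e) - φ(e'))²`. -/
def maxsq (φ : Sym2 V → ℝ) (v : V) : ℝ :=
  sSup ((fun p : G.edgeSet × G.edgeSet =>
      (φ (p.1 : Sym2 V) - φ (p.2 : Sym2 V)) ^ 2) ''
    {p : G.edgeSet × G.edgeSet | v ∈ (p.1 : Sym2 V) ∧ v ∈ (p.2 : Sym2 V)})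

/-- The "Dirichlet form" `S_φ`. -/
def Sphi (a φ : Sym2 V → ℝ) : ℝ :=
  ∑ v : V, (avwt G a v + 1) / 2 * maxsq G φ v

/-- `H_{v₀,v₁}(x) = (1/4) log (x_{v₁}/x_{v₀})`. -/
def Hfun (v₀ v₁ : V) (x : G.edgeSet → ℝ) : ℝ :=
  (1 / 4) * Real.log (vwt G x v₁ / vwt G x v₀)

/-- `log (dQ/dP)` realized via the Radon–Nikodym derivative. -/
def logRN {α : Type*} [MeasurableSpace α] (Q P : Measure α) (x : α) : ℝ :=
  Real.log ((Q.rnDeriv P x).toReal)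

/-- The deformation map `Ξ^{γφ}(x) = (e^{γφ(e)} x_e)_{e∈E}`. -/
def Xi (φ : Sym2 V → ℝ) (γ : ℝ) (x : G.edgeSet → ℝ) : G.edgeSet → ℝ :=
  fun e => Real.exp (γ * φ (e : Sym2 V)) * x e

/-- `Π^{γφ}`, the image of `ℙ_{v₀,v₁,e₀}` under `Ξ^{γφ}`. -/
def PiGamma (a φ : Sym2 V → ℝ) (v₀ v₁ : V) (e₀ : G.edgeSet) (γ : ℝ) :
    Measure (G.edgeSet → ℝ) :=
  Measure.map (Xi G φ γ) (Pm G a v₀ v₁ e₀)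

/-- The explicit realization `f_γ` of `log(dΠ^{γφ}/dℙ_{v₀,v₁,e₀}) ∘ Ξ^{γφ}`. -/
def fgamma (a φ : Sym2 V → ℝ) (v₀ v₁ : V) (γ : ℝ) (x : G.edgeSet → ℝ) : ℝ :=
  γ * (avwt G a v₁ / 2 + 1 / 4) -
    γ * ∑ e : G.edgeSet, φ (e : Sym2 V) * a (e : Sym2 V) +
    (∑ v ∈ Finset.univ \ {v₀, v₁}, (avwt G a v + 1) / 2 *
      Real.log (vwt G (Xi G φ γ x) v / vwt G x v)) -
    (1 / 2) * Real.log (treeSum G (Xi G φ γ x) / treeSum G x)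

/-- Mean of `φ` under the measure `μ_{x,v,γ}` on the edges incident to `v`. -/
def muMean (φ : Sym2 V → ℝ) (γ : ℝ) (x : G.edgeSet → ℝ) (v : V) : ℝ :=
  (∑ e : G.edgeSet, if v ∈ (e : Sym2 V) then φ (e : Sym2 V) * Xi G φ γ x e else 0) /
    vwt G (Xi G φ γ x) v

/-- Variance of `φ` under `μ_{x,v,γ}`. -/
def muVar (φ : Sym2 V → ℝ) (γ : ℝ) (x : G.edgeSet → ℝ) (v : V) : ℝ :=
  (∑ e : G.edgeSet, if v ∈ (e : Sym2 V) then
      (φ (e : Sym2 V) - muMean G φ γ x v) ^ 2 * Xi G φ γ x e else 0) /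
    vwt G (Xi G φ γ x) v

/-- `Δ(T) = ∑_{e ∈ T} φ(e)`. -/
def Delta (φ : Sym2 V → ℝ) (T : Finset G.edgeSet) : ℝ := ∑ e ∈ T, φ (e : Sym2 V)

/-- Mean of `Δ` under the measure `ν_{x,γ}` on spanning trees. -/
def nuMean (φ : Sym2 V → ℝ) (γ : ℝ) (x : G.edgeSet → ℝ) : ℝ :=
  (∑ T : Finset G.edgeSet, if IsSpanningTree G T then
      Delta G φ T * ∏ e ∈ T, Xi G φ γ x e else 0) /
    treeSum G (Xi G φ γ x)

/-- Variance of `Δ` under `ν_{x,γ}`. -/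
def nuVar (φ : Sym2 V → ℝ) (γ : ℝ) (x : G.edgeSet → ℝ) : ℝ :=
  (∑ T : Finset G.edgeSet, if IsSpanningTree G T then
      (Delta G φ T - nuMean G φ γ x) ^ 2 * ∏ e ∈ T, Xi G φ γ x e else 0) /
    treeSum G (Xi G φ γ x)

/-- The claimed first derivative of `γ ↦ f_γ(x)`. -/
def fder1 (a φ : Sym2 V → ℝ) (v₀ v₁ : V) (x : G.edgeSet → ℝ) (γ : ℝ) : ℝ :=
  avwt G a v₁ / 2 + 1 / 4 - (∑ e : G.edgeSet, φ (e : Sym2 V) * a (e : Sym2 V)) +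
    (∑ v ∈ Finset.univ \ {v₀, v₁}, (avwt G a v + 1) / 2 * muMean G φ γ x v) -
    (1 / 2) * nuMean G φ γ x

/-- The claimed second derivative of `γ ↦ f_γ(x)`. -/
def fder2 (a φ : Sym2 V → ℝ) (v₀ v₁ : V) (x : G.edgeSet → ℝ) (γ : ℝ) : ℝ :=
  (∑ v ∈ Finset.univ \ {v₀, v₁}, (avwt G a v + 1) / 2 * muVar G φ γ x v) -
    (1 / 2) * nuVar G φ γ x

/-- Membership in the class `𝒫` of the variational principle. -/
def VarP (a : Sym2 V → ℝ) (v₀ v₁ : V) (e₀ : G.edgeSet)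
    (Q : Measure (G.edgeSet → ℝ)) : Prop :=
  IsProbabilityMeasure Q ∧ Q ≪ Pm G a v₀ v₁ e₀ ∧ Pm G a v₀ v₁ e₀ ≪ Q ∧
    Integrable (Hfun G v₀ v₁) Q ∧ Integrable (logRN Q (Pm G a v₀ v₁ e₀)) Q

/-- The functional `F(Π) = E_Π[H] + E_Π[log(dΠ/dℙ_{v₀,v₁,e₀})]`. -/
def Ffun (a : Sym2 V → ℝ) (v₀ v₁ : V) (e₀ : G.edgeSet)
    (Q : Measure (G.edgeSet → ℝ)) : ℝ :=
  (∫ x, Hfun G v₀ v₁ x ∂Q) + ∫ x, logRN Q (Pm G a v₀ v₁ e₀) x ∂Q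

end

end ERRWGraph

namespace ERRWGraph

set_option linter.unusedSectionVars false

section Combinatorics

variable {V : Type*} [Fintype V] [DecidableEq V] {G : SimpleGraph V} [Fintype G.edgeSet]

lemma sum_ite_mem_edge (e : G.edgeSet) (c : ℝ) :
    (∑ v : V, if v ∈ (e : Sym2 V) then c else 0) = 2 * c := by
  obtain ⟨e, he⟩ := e
  induction e using Sym2.ind with
  | _ u v =>
    have huv : u ≠ v := G.ne_of_adj he
    have : (Finset.univ.filter fun w : V => w ∈ s(u, v)) = {u, v} := by
      ext w; simp
    rw [← Finset.sum_filter, this, Finset.sum_pair huv, two_mul]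

lemma sum_avwt (a : Sym2 V → ℝ) : ∑ v, avwt G a v = 2 * ∑ e : G.edgeSet, a e := by
  simp only [avwt]
  rw [Finset.sum_comm, Finset.mul_sum]
  exact Finset.sum_congr rfl fun e _ => sum_ite_mem_edge e _

lemma edgeSet_fromEdgeSet_image (T : Finset G.edgeSet) :
    (SimpleGraph.fromEdgeSet (Subtype.val '' (T : Set G.edgeSet))).edgeSet =
      Subtype.val '' (T : Set G.edgeSet) := by
  rw [SimpleGraph.edgeSet_fromEdgeSet]
  refine sdiff_eq_left.2 (Set.disjoint_left.2 ?_)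
  rintro _ ⟨e, _, rfl⟩ h
  exact G.not_isDiag_of_mem_edgeSet e.2 h

lemma IsSpanningTree.card_add_one {T : Finset G.edgeSet} (hT : IsSpanningTree G T) :
    T.card + 1 = Fintype.card V := by
  rw [← SimpleGraph.IsTree.card_edgeFinset hT]
  congr 1
  rw [SimpleGraph.edgeFinset, Set.toFinset_card, ← Nat.card_eq_fintype_card,
    edgeSet_fromEdgeSet_image,
    Nat.card_image_of_injective Subtype.val_injective]
  simp

lemma exists_isSpanningTree (hG : G.Connected) : ∃ T, IsSpanningTree G T := by
  obtain ⟨T, hle, hT⟩ := hG.exists_isTree_le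
  refine ⟨Finset.univ.filter fun e => (e : Sym2 V) ∈ T.edgeSet, ?_⟩
  have : Subtype.val '' ((Finset.univ.filter fun e : G.edgeSet => (e : Sym2 V) ∈ T.edgeSet :
      Finset G.edgeSet) : Set G.edgeSet) = T.edgeSet := by
    ext e
    simp only [Finset.coe_filter, Finset.mem_univ, true_and, Set.mem_image, Set.mem_ofPred_eq]
    exact ⟨by rintro ⟨x, hx, rfl⟩; exact hx,
      fun h => ⟨⟨e, SimpleGraph.edgeSet_mono hle h⟩, h, rfl⟩⟩
  rw [IsSpanningTree, this, SimpleGraph.fromEdgeSet_edgeSet]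
  exact hT

lemma exists_mem_edge (hG : G.Connected) {v w : V} (hvw : v ≠ w) (u : V) :
    ∃ e : G.edgeSet, u ∈ (e : Sym2 V) := by
  have : Nontrivial V := ⟨v, w, hvw⟩
  obtain ⟨t, ht⟩ := hG.preconnected.exists_adj_of_nontrivial u
  exact ⟨⟨s(u, t), ht⟩, by simp⟩

lemma isSpanningTree_map_iff (f : G ≃g G) (T : Finset G.edgeSet) :
    IsSpanningTree G (T.map f.mapEdgeSet.toEmbedding) ↔ IsSpanningTree G T := by
  refine (SimpleGraph.Iso.isTree_iff ⟨f.toEquiv, ?_⟩).symm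
  intro u v
  simp only [SimpleGraph.fromEdgeSet_adj, ne_eq, Set.mem_image, Finset.mem_coe, Finset.mem_map]
  refine and_congr ⟨?_, ?_⟩ (not_congr f.toEquiv.apply_eq_iff_eq)
  · rintro ⟨_, ⟨e, he, rfl⟩, h⟩
    refine ⟨e, he, Sym2.map.injective f.injective ?_⟩
    exact h
  · rintro ⟨e, he, h⟩
    refine ⟨_, ⟨e, he, rfl⟩, ?_⟩
    change Sym2.map f e = _
    rw [h]
    rfl

lemma vwt_comp (f : G ≃g G) (x : G.edgeSet → ℝ) (v : V) :
    vwt G (fun e => x (f.mapEdgeSet e)) v = vwt G x (f v) := by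
  unfold vwt
  rw [← Equiv.sum_comp f.mapEdgeSet fun e => if f v ∈ (e : Sym2 V) then x e else 0]
  refine Finset.sum_congr rfl fun e _ => ?_
  have : f v ∈ (f.mapEdgeSet e : Sym2 V) ↔ v ∈ (e : Sym2 V) := by
    change f v ∈ Sym2.map f e ↔ _
    rw [Sym2.mem_map]
    exact ⟨fun ⟨w, hw, h⟩ => f.injective h ▸ hw, fun h => ⟨v, h, rfl⟩⟩
  simp only [this]

lemma avwt_eq_vwt (a : Sym2 V → ℝ) (v : V) : avwt G a v = vwt G (fun e => a e) v := rfl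

lemma treeSum_comp (f : G ≃g G) (x : G.edgeSet → ℝ) :
    treeSum G (fun e => x (f.mapEdgeSet e)) = treeSum G x := by
  unfold treeSum
  rw [← Equiv.sum_comp f.mapEdgeSet.finsetCongr fun T : Finset G.edgeSet =>
    if IsSpanningTree G T then ∏ e ∈ T, x e else 0]
  refine Finset.sum_congr rfl fun T _ => ?_
  rw [Equiv.finsetCongr_apply]
  simp only [isSpanningTree_map_iff, Finset.prod_map]
  rfl

lemma vwt_smul (c : ℝ) (x : G.edgeSet → ℝ) (v : V) :
    vwt G (fun e => c * x e) v = c * vwt G x v := by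
  simp [vwt, Finset.mul_sum]

lemma treeSum_smul (c : ℝ) (x : G.edgeSet → ℝ) :
    treeSum G (fun e => c * x e) = c ^ (Fintype.card V - 1) * treeSum G x := by
  unfold treeSum
  rw [Finset.mul_sum]
  refine Finset.sum_congr rfl fun T _ => ?_
  split_ifs with hT
  · rw [Finset.prod_mul_distrib, Finset.prod_const, ← hT.card_add_one, Nat.add_sub_cancel]
  · simp

lemma vwt_pos (hG : G.Connected) {v w : V} (hvw : v ≠ w) {x : G.edgeSet → ℝ}
    (hx : ∀ e, 0 < x e) (u : V) : 0 < vwt G x u := by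
  obtain ⟨e, he⟩ := exists_mem_edge hG hvw u
  refine Finset.sum_pos' (fun e _ => ?_) ⟨e, Finset.mem_univ _, ?_⟩
  · split_ifs
    exacts [(hx e).le, le_rfl]
  · simpa [he] using hx e

lemma treeSum_pos (hG : G.Connected) {x : G.edgeSet → ℝ} (hx : ∀ e, 0 < x e) :
    0 < treeSum G x := by
  obtain ⟨T, hT⟩ := exists_isSpanningTree hG
  refine Finset.sum_pos' (fun e _ => ?_) ⟨T, Finset.mem_univ _, ?_⟩
  · split_ifs
    exacts [Finset.prod_nonneg fun e _ => (hx e).le, le_rfl]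
  · simpa [hT] using Finset.prod_pos fun e _ => hx e

lemma IsAut.exists_iso {a : Sym2 V → ℝ} {f : V → V} (hf : IsAut G a f) :
    ∃ g : G ≃g G, (∀ v, g v = f v) ∧ ∀ e : G.edgeSet, a (g.mapEdgeSet e) = a e := by
  obtain ⟨hb, hadj, ha⟩ := hf
  refine ⟨⟨Equiv.ofBijective f hb, fun {u v} => hadj u v⟩, fun _ => rfl, ?_⟩
  rintro ⟨e, he⟩
  induction e using Sym2.ind with
  | _ u v => exact ha u v he

/-- The part of `Phi` that does not depend on the starting vertex. -/
noncomputable def symPhi (G : SimpleGraph V) [Fintype G.edgeSet] (a : Sym2 V → ℝ)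
    (x : G.edgeSet → ℝ) : ℝ :=
  (∏ e : G.edgeSet, x e ^ a (e : Sym2 V)) * (∏ v, vwt G x v ^ (-(avwt G a v + 1) / 2)) *
    Real.sqrt (treeSum G x)

lemma Phi_eq_sqrt_mul_symPhi (hG : G.Connected) {v w : V} (hvw : v ≠ w) {x : G.edgeSet → ℝ}
    (hx : ∀ e, 0 < x e) (a : Sym2 V → ℝ) (u : V) :
    Phi G a u x = Real.sqrt (vwt G x u) * symPhi G a x := by
  have h : vwt G x u ^ (-avwt G a u / 2) =
      Real.sqrt (vwt G x u) * vwt G x u ^ (-(avwt G a u + 1) / 2) := by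
    rw [Real.sqrt_eq_rpow, ← Real.rpow_add (vwt_pos hG hvw hx u)]
    ring_nf
  rw [Phi, symPhi, h, ← Finset.mul_prod_erase _ _ (Finset.mem_univ u)]
  ring

lemma symPhi_pos (hG : G.Connected) {v w : V} (hvw : v ≠ w) {x : G.edgeSet → ℝ}
    (hx : ∀ e, 0 < x e) (a : Sym2 V → ℝ) : 0 < symPhi G a x :=
  mul_pos (mul_pos (Finset.prod_pos fun e _ => Real.rpow_pos_of_pos (hx e) _)
    (Finset.prod_pos fun u _ => Real.rpow_pos_of_pos (vwt_pos hG hvw hx u) _))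
    (Real.sqrt_pos.2 (treeSum_pos hG hx))

lemma Phi_pos (hG : G.Connected) {v w : V} (hvw : v ≠ w) {x : G.edgeSet → ℝ}
    (hx : ∀ e, 0 < x e) (a : Sym2 V → ℝ) (u : V) : 0 < Phi G a u x := by
  rw [Phi_eq_sqrt_mul_symPhi hG hvw hx]
  exact mul_pos (Real.sqrt_pos.2 (vwt_pos hG hvw hx u)) (symPhi_pos hG hvw hx a)

lemma Phi_eq_Phi_mul_exp (hG : G.Connected) {v w : V} (hvw : v ≠ w) {x : G.edgeSet → ℝ}
    (hx : ∀ e, 0 < x e) (a : Sym2 V → ℝ) :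
    Phi G a w x = Phi G a v x * Real.exp (2 * Hfun G v w x) := by
  have hv := vwt_pos hG hvw hx v
  have hw := vwt_pos hG hvw hx w
  have : Real.exp (2 * Hfun G v w x) = Real.sqrt (vwt G x w) / Real.sqrt (vwt G x v) := by
    rw [← Real.sqrt_div hw.le, Real.sqrt_eq_rpow, Real.rpow_def_of_pos (div_pos hw hv), Hfun]
    ring_nf
  rw [Phi_eq_sqrt_mul_symPhi hG hvw hx, Phi_eq_sqrt_mul_symPhi hG hvw hx, this]
  field_simp [(Real.sqrt_pos.2 hv).ne']

lemma symPhi_smul (hG : G.Connected) {v w : V} (hvw : v ≠ w) {x : G.edgeSet → ℝ}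
    (hx : ∀ e, 0 < x e) (a : Sym2 V → ℝ) {c : ℝ} (hc : 0 < c) :
    symPhi G a (fun e => c * x e) = c ^ (-(1 / 2) : ℝ) * symPhi G a x := by
  have h1 : ∏ e : G.edgeSet, (c * x e) ^ a (e : Sym2 V) =
      c ^ (∑ e : G.edgeSet, a e) * ∏ e : G.edgeSet, x e ^ a (e : Sym2 V) := by
    rw [Real.rpow_sum_of_pos hc, ← Finset.prod_mul_distrib]
    exact Finset.prod_congr rfl fun e _ => Real.mul_rpow hc.le (hx e).le
  have h2 : ∏ u, (c * vwt G x u) ^ (-(avwt G a u + 1) / 2) =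
      c ^ (∑ u, (-(avwt G a u + 1) / 2)) * ∏ u, vwt G x u ^ (-(avwt G a u + 1) / 2) := by
    rw [Real.rpow_sum_of_pos hc, ← Finset.prod_mul_distrib]
    exact Finset.prod_congr rfl fun u _ => Real.mul_rpow hc.le (vwt_pos hG hvw hx u).le
  have h3 : Real.sqrt (c ^ (Fintype.card V - 1) * treeSum G x) =
      c ^ (((Fintype.card V : ℝ) - 1) / 2) * Real.sqrt (treeSum G x) := by
    rw [Real.sqrt_mul (by positivity), Real.sqrt_eq_rpow, ← Real.rpow_natCast,
      ← Real.rpow_mul hc.le, Nat.cast_pred (Fintype.card_pos_iff.2 ⟨v⟩)]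
    ring_nf
  have h4 : ∑ u, (-(avwt G a u + 1) / 2) = -(∑ e : G.edgeSet, a e) - (Fintype.card V : ℝ) / 2 := by
    rw [← Finset.sum_div, Finset.sum_neg_distrib, Finset.sum_add_distrib, sum_avwt]
    simp
    ring
  have h5 : c ^ (-(1 / 2) : ℝ) = c ^ (∑ e : G.edgeSet, a e) *
      c ^ (∑ u, (-(avwt G a u + 1) / 2)) * c ^ (((Fintype.card V : ℝ) - 1) / 2) := by
    rw [← Real.rpow_add hc, ← Real.rpow_add hc, h4]
    ring_nf
  simp only [symPhi, vwt_smul, treeSum_smul]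
  rw [h1, h2, h3, h5]
  ring

lemma Phi_smul (hG : G.Connected) {v w : V} (hvw : v ≠ w) {x : G.edgeSet → ℝ}
    (hx : ∀ e, 0 < x e) (a : Sym2 V → ℝ) (u : V) {c : ℝ} (hc : 0 < c) :
    Phi G a u (fun e => c * x e) = Phi G a u x := by
  rw [Phi_eq_sqrt_mul_symPhi hG hvw hx, Phi_eq_sqrt_mul_symPhi hG hvw (fun e => mul_pos hc (hx e)),
    symPhi_smul hG hvw hx a hc, vwt_smul, Real.sqrt_mul hc.le, Real.sqrt_eq_rpow c]
  have : c ^ (1 / 2 : ℝ) * c ^ (-(1 / 2) : ℝ) = 1 := by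
    rw [← Real.rpow_add hc]; simp
  linear_combination (√(vwt G x u) * symPhi G a x) * this

lemma Phi_comp (hG : G.Connected) {v w : V} (hvw : v ≠ w) {x : G.edgeSet → ℝ}
    (hx : ∀ e, 0 < x e) {a : Sym2 V → ℝ} (f : G ≃g G)
    (hf : ∀ e : G.edgeSet, a (f.mapEdgeSet e) = a e) (u : V) :
    Phi G a u (fun e => x (f.mapEdgeSet e)) = Phi G a (f u) x := by
  have hav : ∀ v, avwt G a (f.toEquiv v) = avwt G a v := fun v => by
    rw [avwt_eq_vwt, avwt_eq_vwt]
    refine (vwt_comp f _ v).symm.trans ?_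
    simp only [hf]
  rw [Phi_eq_sqrt_mul_symPhi hG hvw hx, Phi_eq_sqrt_mul_symPhi hG hvw (fun e => hx _), vwt_comp]
  simp only [symPhi, vwt_comp, treeSum_comp]
  rw [← Equiv.prod_comp f.mapEdgeSet fun e => x e ^ a (e : Sym2 V),
    ← Equiv.prod_comp f.toEquiv fun v => vwt G x v ^ (-(avwt G a v + 1) / 2)]
  simp only [hf, hav]
  rfl

end Combinatorics

section LogCoordinates

open Set

lemma logMeasure_eq_map_exp : logMeasure = Measure.map Real.exp volume := by
  ext s hs
  rw [Measure.map_apply Real.measurable_exp hs, logMeasure, withDensity_apply _ hs,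
    ← lintegral_indicator hs, ← Real.range_exp, ← image_univ,
    lintegral_image_eq_lintegral_abs_deriv_mul MeasurableSet.univ
      (fun x _ => (Real.hasDerivAt_exp x).hasDerivWithinAt) Real.exp_injective.injOn,
    Measure.restrict_univ, ← lintegral_indicator_one (hs.preimage Real.measurable_exp)]
  refine lintegral_congr fun x => ?_
  by_cases h : Real.exp x ∈ s
  · rw [indicator_of_mem h, indicator_of_mem (by exact h), ← ENNReal.ofReal_mul (abs_nonneg _),
      abs_of_pos (Real.exp_pos x), mul_one_div_cancel (Real.exp_pos x).ne']
    simp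
  · rw [indicator_of_notMem h, indicator_of_notMem (by exact h), mul_zero]

variable {ι : Type*} [Fintype ι] [DecidableEq ι]

/-- The product measure with a Dirac mass at `0` in coordinate `i` and Lebesgue measure in all
other coordinates. -/
noncomputable def pinnedVolume (i : ι) : Measure (ι → ℝ) :=
  Measure.pi fun j => if j = i then Measure.dirac 0 else volume

instance (i j : ι) : SigmaFinite (if j = i then Measure.dirac 0 else volume : Measure ℝ) := by
  split_ifs <;> infer_instance

instance (i : ι) : SigmaFinite (pinnedVolume i) := by
  unfold pinnedVolume; infer_instance

lemma pinnedVolume_ne_zero (i : ι) : pinnedVolume i ≠ 0 := by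
  rw [← Measure.measure_univ_ne_zero, pinnedVolume, Measure.pi_univ, Finset.prod_ne_zero_iff]
  intro j _
  split_ifs <;> simp

lemma measurePreserving_add_pinnedVolume (i : ι) {c : ι → ℝ} (hc : c i = 0) :
    MeasurePreserving (fun y j => c j + y j) (pinnedVolume i) (pinnedVolume i) := by
  refine measurePreserving_pi _ _ fun j => ?_
  split_ifs with h
  · subst h
    have : (HAdd.hAdd (c j) : ℝ → ℝ) = id := by ext; simp [hc]
    rw [this]
    exact MeasurePreserving.id _
  · exact measurePreserving_add_left volume (c j)

lemma lintegral_indicator_Icc_add (s : ℝ) :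
    ∫⁻ t, (Icc (0 : ℝ) 1).indicator (1 : ℝ → ℝ≥0∞) (s + t) = 1 := by
  rw [lintegral_add_left_eq_self (fun t => (Icc (0 : ℝ) 1).indicator (1 : ℝ → ℝ≥0∞) t),
    lintegral_indicator_one measurableSet_Icc]
  simp

lemma lintegral_mul_indicator_swap {F : (ι → ℝ) → ℝ≥0∞} (hF : Measurable F)
    (hinv : ∀ y t, F (fun j => y j + t) = F y) (i j : ι) :
    ∫⁻ y, F y * (Icc (0 : ℝ) 1).indicator 1 (y i) =
      ∫⁻ y, F y * (Icc (0 : ℝ) 1).indicator 1 (y j) := by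
  set g : ℝ → ℝ≥0∞ := (Icc (0 : ℝ) 1).indicator 1 with hg
  have gm : Measurable g := measurable_one.indicator measurableSet_Icc
  have e1 : ∫⁻ y, F y * g (y i) = ∫⁻ y, ∫⁻ t : ℝ, F y * g (y i) * g (y j + t) := by
    refine lintegral_congr fun y => ?_
    rw [lintegral_const_mul _ (by fun_prop), hg, lintegral_indicator_Icc_add, mul_one]
  have e2 : ∀ t : ℝ, ∫⁻ y, F y * g (y i) * g (y j + t) =
      ∫⁻ y, F y * g (y j) * g (y i - t) := by
    intro t
    rw [← lintegral_add_right_eq_self (fun y => F y * g (y j) * g (y i - t)) (fun _ : ι => t)]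
    refine lintegral_congr fun y => ?_
    have : F (y + fun _ => t) = F y := hinv y t
    simp only [Pi.add_apply, add_sub_cancel_right, this]
    ring
  have e3 : ∫⁻ y, F y * g (y j) = ∫⁻ y, ∫⁻ t : ℝ, F y * g (y j) * g (y i - t) := by
    refine lintegral_congr fun y => ?_
    rw [lintegral_const_mul _ (by fun_prop), lintegral_sub_left_eq_self g (y i), hg,
      lintegral_indicator_one measurableSet_Icc]
    simp
  rw [e1, e3, lintegral_lintegral_swap (by fun_prop),
    lintegral_lintegral_swap (f := fun y t => F y * g (y j) * g (y i - t)) (by fun_prop)]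
  exact lintegral_congr e2

lemma lintegral_pinnedVolume {F : (ι → ℝ) → ℝ≥0∞} (hF : Measurable F)
    (hinv : ∀ y t, F (fun j => y j + t) = F y) (i : ι) :
    ∫⁻ y, F y ∂pinnedVolume i = ∫⁻ y, F y * (Icc (0 : ℝ) 1).indicator 1 (y i) := by
  set g : ℝ → ℝ≥0∞ := (Icc (0 : ℝ) 1).indicator 1 with hg
  have gm : Measurable g := measurable_one.indicator measurableSet_Icc
  set μ : ι → Measure ℝ := fun j => if j = i then Measure.dirac 0 else volume with hμ
  set s : Finset ι := Finset.univ.erase i with hs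
  have hμs : (fun j : s => μ j) = fun _ => volume := by
    ext1 j
    exact if_neg (Finset.ne_of_mem_erase j.2)
  have h0 : lmarginal μ s F = lmarginal (fun _ => volume) s F := by
    ext x
    rw [lmarginal, lmarginal, hμs]
  have hm (t : ℝ) : lmarginal (fun _ => volume) s (fun y => F y * g (y i))
      (Function.update 0 i t) = lmarginal (fun _ => volume) s F 0 * g t := by
    have hu (x : ι → ℝ) (y : s → ℝ) : Function.updateFinset x s y i = x i := by
      simp [Function.updateFinset, hs]
    simp only [lmarginal, hu, Function.update_self]
    rw [lintegral_mul_const (f := fun y => F (Function.updateFinset (Function.update 0 i t) s y)) _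
      (hF.comp measurable_updateFinset)]
    congr 1
    rw [← volume_pi, ← lintegral_sub_right_eq_self
      (fun y : s → ℝ => F (Function.updateFinset 0 s y)) (fun _ => t)]
    refine lintegral_congr fun y => ?_
    rw [← hinv (Function.updateFinset 0 s _) t]
    congr 1
    ext j
    by_cases h : j = i
    · subst h; simp [Function.updateFinset, hs]
    · simp [Function.updateFinset, hs, h]
  have : ∀ j, SigmaFinite (μ j) := fun j => by rw [hμ]; infer_instance
  have e1 := lmarginal_erase (μ := μ) F hF (Finset.mem_univ i) 0
  have e2 := lmarginal_erase (μ := fun _ : ι => (volume : Measure ℝ))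
    (fun y => F y * g (y i)) (by fun_prop) (Finset.mem_univ i) 0
  rw [pinnedVolume, ← hμ, lintegral_eq_lmarginal_univ (μ := μ) 0, volume_pi,
    lintegral_eq_lmarginal_univ (μ := fun _ => volume) 0, e1, e2]
  simp only [← hs, hm, h0]
  rw [lintegral_const_mul _ gm, hg, lintegral_indicator_one measurableSet_Icc, hμ]
  simp

end LogCoordinates

section Tame

variable {ι : Type*}

/-- Positive functions on `(0,∞)^ι` whose values at two points with uniformly comparable
coordinates are comparable. -/
def Tame (F : (ι → ℝ) → ℝ) : Prop :=
  (∀ x, (∀ i, 0 < x i) → 0 < F x) ∧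
    ∀ K : ℝ, ∃ C, 0 < C ∧ ∀ x y, (∀ i, 0 < x i) → (∀ i, 0 < y i) → (∀ i, x i ≤ K * y i) →
      (∀ i, y i ≤ K * x i) → F x ≤ C * F y

lemma tame_apply (i : ι) : Tame fun x : ι → ℝ => x i := by
  refine ⟨fun x hx => hx i, fun K => ⟨|K| + 1, by positivity, fun x y hx hy h _ => ?_⟩⟩
  nlinarith [h i, hy i, le_abs_self K]

lemma tame_const {c : ℝ} (hc : 0 < c) : Tame fun _ : ι → ℝ => c :=
  ⟨fun _ _ => hc, fun _ => ⟨1, one_pos, fun _ _ _ _ _ _ => (one_mul c).ge⟩⟩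

variable {F F' : (ι → ℝ) → ℝ}

lemma Tame.mul (hF : Tame F) (hF' : Tame F') : Tame fun x => F x * F' x := by
  refine ⟨fun x hx => mul_pos (hF.1 x hx) (hF'.1 x hx), fun K => ?_⟩
  obtain ⟨C, hC, h⟩ := hF.2 K
  obtain ⟨C', hC', h'⟩ := hF'.2 K
  refine ⟨C * C', mul_pos hC hC', fun x y hx hy h1 h2 => ?_⟩
  calc F x * F' x ≤ (C * F y) * (C' * F' y) :=
        mul_le_mul (h x y hx hy h1 h2) (h' x y hx hy h1 h2) (hF'.1 x hx).le
          (mul_pos hC (hF.1 y hy)).le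
    _ = C * C' * (F y * F' y) := by ring

lemma Tame.add (hF : Tame F) (hF' : Tame F') : Tame fun x => F x + F' x := by
  refine ⟨fun x hx => add_pos (hF.1 x hx) (hF'.1 x hx), fun K => ?_⟩
  obtain ⟨C, hC, h⟩ := hF.2 K
  obtain ⟨C', hC', h'⟩ := hF'.2 K
  refine ⟨C + C', add_pos hC hC', fun x y hx hy h1 h2 => ?_⟩
  have := h x y hx hy h1 h2
  have := h' x y hx hy h1 h2
  have := mul_pos hC (hF'.1 y hy)
  have := mul_pos hC' (hF.1 y hy)
  linarith

lemma Tame.rpow (hF : Tame F) (p : ℝ) : Tame fun x => F x ^ p := by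
  refine ⟨fun x hx => Real.rpow_pos_of_pos (hF.1 x hx) p, fun K => ?_⟩
  obtain ⟨C, hC, h⟩ := hF.2 K
  refine ⟨C ^ |p|, Real.rpow_pos_of_pos hC _, fun x y hx hy h1 h2 => ?_⟩
  have hFx := hF.1 x hx
  have hFy := hF.1 y hy
  obtain hp | hp := le_total 0 p
  · rw [abs_of_nonneg hp, ← Real.mul_rpow hC.le hFy.le]
    exact Real.rpow_le_rpow hFx.le (h x y hx hy h1 h2) hp
  · rw [abs_of_nonpos hp]
    have : (C * F x) ^ p ≤ F y ^ p := Real.rpow_le_rpow_of_nonpos hFy (h y x hy hx h2 h1) hp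
    rw [Real.mul_rpow hC.le hFx.le] at this
    rw [Real.rpow_neg hC.le, ← div_eq_inv_mul, le_div_iff₀ (Real.rpow_pos_of_pos hC p)]
    linarith

lemma Tame.sqrt (hF : Tame F) : Tame fun x => Real.sqrt (F x) := by
  simpa only [Real.sqrt_eq_rpow] using hF.rpow (1 / 2)

lemma tame_prod {κ : Type*} (s : Finset κ) {f : κ → (ι → ℝ) → ℝ} (hf : ∀ k ∈ s, Tame (f k)) :
    Tame fun x => ∏ k ∈ s, f k x := by
  induction s using Finset.cons_induction with
  | empty => simpa using tame_const one_pos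
  | cons k s hk ih =>
    simp only [Finset.prod_cons]
    exact (hf k (by simp)).mul (ih fun j hj => hf j (by simp [hj]))

lemma tame_sum {κ : Type*} {s : Finset κ} (hs : s.Nonempty) {f : κ → (ι → ℝ) → ℝ}
    (hf : ∀ k ∈ s, Tame (f k)) : Tame fun x => ∑ k ∈ s, f k x := by
  induction hs using Finset.Nonempty.cons_induction with
  | singleton k => simpa using hf k (by simp)
  | cons k s hk _ ih =>
    simp only [Finset.sum_cons]
    exact (hf k (by simp)).add (ih fun j hj => hf j (by simp [hj]))

end Tame

section Regularity

variable {V : Type*} [Fintype V] [DecidableEq V] {G : SimpleGraph V} [Fintype G.edgeSet]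

lemma tame_vwt (hG : G.Connected) {v w : V} (hvw : v ≠ w) (u : V) :
    Tame fun x => vwt G x u := by
  simp only [vwt, ← Finset.sum_filter]
  obtain ⟨e, he⟩ := exists_mem_edge hG hvw u
  exact tame_sum ⟨e, by simpa using he⟩ fun e _ => tame_apply e

lemma tame_treeSum (hG : G.Connected) : Tame (treeSum G) := by
  unfold treeSum
  simp only [← Finset.sum_filter]
  obtain ⟨T, hT⟩ := exists_isSpanningTree hG
  exact tame_sum ⟨T, by simpa using hT⟩ fun T _ => tame_prod _ fun e _ => tame_apply e

lemma tame_Phi (hG : G.Connected) {v w : V} (hvw : v ≠ w) (a : Sym2 V → ℝ) (u : V) :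
    Tame (Phi G a u) := by
  unfold Phi
  exact (((tame_prod _ fun e _ => (tame_apply e).rpow _).mul ((tame_vwt hG hvw u).rpow _)).mul
    (tame_prod _ fun e _ => (tame_vwt hG hvw e).rpow _)).mul (tame_treeSum hG).sqrt

@[fun_prop]
lemma measurable_vwt (u : V) : Measurable fun x => vwt G x u := by
  simp only [vwt, ← Finset.sum_filter]
  fun_prop

@[fun_prop]
lemma measurable_treeSum : Measurable (treeSum G) := by
  unfold treeSum
  simp only [← Finset.sum_filter]
  fun_prop

@[fun_prop]
lemma measurable_Phi (a : Sym2 V → ℝ) (u : V) : Measurable (Phi G a u) := by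
  unfold Phi
  fun_prop

@[fun_prop]
lemma measurable_Hfun (v w : V) : Measurable (Hfun G v w) := by
  unfold Hfun
  fun_prop

@[fun_prop]
lemma measurable_interpDens (a : Sym2 V → ℝ) (v w : V) (e₀ : G.edgeSet) :
    Measurable (interpDens G a v w e₀) := by
  unfold interpDens
  fun_prop

@[fun_prop]
lemma measurable_Xi (φ : Sym2 V → ℝ) (γ : ℝ) : Measurable (Xi G φ γ) := by
  unfold Xi
  fun_prop

instance : SigmaFinite logMeasure := by
  unfold logMeasure
  exact SigmaFinite.withDensity_ofReal _

instance {ι : Type*} [DecidableEq ι] (i j : ι) :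
    SigmaFinite (if j = i then Measure.dirac 1 else logMeasure) := by
  split_ifs <;> infer_instance

instance (e₀ : G.edgeSet) : SigmaFinite (rho G e₀) := by
  unfold rho
  infer_instance

lemma measurable_exp_pi {ι : Type*} : Measurable fun (y : ι → ℝ) i => Real.exp (y i) := by
  fun_prop

lemma rho_eq_map_exp (e₀ : G.edgeSet) :
    rho G e₀ = (pinnedVolume e₀).map fun y e => Real.exp (y e) := by
  have (e : G.edgeSet) : (if e = e₀ then Measure.dirac 1 else logMeasure) =
      (if e = e₀ then Measure.dirac 0 else volume : Measure ℝ).map Real.exp := by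
    split_ifs
    · rw [Measure.map_dirac' Real.measurable_exp, Real.exp_zero]
    · exact logMeasure_eq_map_exp
  have h (e : G.edgeSet) : SigmaFinite
      ((if e = e₀ then Measure.dirac 0 else volume : Measure ℝ).map Real.exp) := by
    rw [← this]; infer_instance
  rw [rho, pinnedVolume, Measure.pi_map_pi fun e => Real.measurable_exp.aemeasurable]
  simp only [this]

lemma lintegral_rho {F : (G.edgeSet → ℝ) → ℝ≥0∞} (hF : Measurable F) (e₀ : G.edgeSet) :
    ∫⁻ x, F x ∂rho G e₀ = ∫⁻ y, F (fun e => Real.exp (y e)) ∂pinnedVolume e₀ := by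
  rw [rho_eq_map_exp, lintegral_map hF (by fun_prop)]

lemma rho_ne_zero (e₀ : G.edgeSet) : rho G e₀ ≠ 0 := by
  rw [rho_eq_map_exp, Ne, Measure.map_eq_zero_iff measurable_exp_pi.aemeasurable]
  exact pinnedVolume_ne_zero e₀

lemma ae_rho_pos (e₀ : G.edgeSet) : ∀ᵐ x ∂rho G e₀, ∀ e, 0 < x e := by
  rw [rho_eq_map_exp, ae_map_iff measurable_exp_pi.aemeasurable]
  · exact .of_forall fun y e => Real.exp_pos _
  · measurability

lemma measurePreserving_Xi {φ : Sym2 V → ℝ} {e₀ : G.edgeSet} (hφ : φ e₀ = 0) (γ : ℝ) :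
    MeasurePreserving (Xi G φ γ) (rho G e₀) (rho G e₀) := by
  refine ⟨by fun_prop, ?_⟩
  have h := measurePreserving_add_pinnedVolume e₀ (c := fun e : G.edgeSet => γ * φ e)
    (by simp [hφ])
  have hcomp : Xi G φ γ ∘ (fun (y : G.edgeSet → ℝ) e => Real.exp (y e)) =
      (fun (y : G.edgeSet → ℝ) e => Real.exp (y e)) ∘ fun y e => γ * φ e + y e := by
    ext y e
    simp [Xi, Real.exp_add]
  rw [rho_eq_map_exp, Measure.map_map (by fun_prop) measurable_exp_pi, hcomp,
    ← Measure.map_map measurable_exp_pi h.measurable, h.map_eq]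

lemma z_eq (hG : G.Connected) {v w : V} (hvw : v ≠ w) (a : Sym2 V → ℝ) (u : V)
    (e₀ e₁ : G.edgeSet) :
    z G a u e₀ = ∫⁻ y : G.edgeSet → ℝ, ENNReal.ofReal (Phi G a u fun e => Real.exp (y e)) *
      (Set.Icc (0 : ℝ) 1).indicator 1 (y e₁) := by
  have hinv : ∀ (y : G.edgeSet → ℝ) (t : ℝ),
      ENNReal.ofReal (Phi G a u fun e => Real.exp (y e + t)) =
        ENNReal.ofReal (Phi G a u fun e => Real.exp (y e)) := fun y t => by
    rw [← Phi_smul hG hvw (fun e => Real.exp_pos (y e)) a u (Real.exp_pos t)]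
    simp only [Real.exp_add, mul_comm]
  rw [z, lintegral_rho (by fun_prop), lintegral_pinnedVolume (by fun_prop) hinv]
  exact lintegral_mul_indicator_swap (by fun_prop) hinv e₀ e₁

lemma z_eq_z_of_iso (hG : G.Connected) {v w : V} (hvw : v ≠ w) {a : Sym2 V → ℝ} (f : G ≃g G)
    (hf : ∀ e : G.edgeSet, a (f.mapEdgeSet e) = a e) (u : V) (e₀ : G.edgeSet) :
    z G a (f u) e₀ = z G a u e₀ := by
  have hm : Measurable fun y : G.edgeSet → ℝ =>
      ENNReal.ofReal (Phi G a u fun e => Real.exp (y e)) *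
        (Set.Icc (0 : ℝ) 1).indicator 1 (y e₀) :=
    (((measurable_Phi a u).comp measurable_exp_pi).ennreal_ofReal).mul
      ((measurable_one.indicator measurableSet_Icc).comp (measurable_pi_apply e₀))
  rw [z_eq hG hvw a u e₀ e₀, z_eq hG hvw a (f u) e₀ (f.mapEdgeSet e₀),
    ← (volume_measurePreserving_piCongrLeft (fun _ => ℝ) f.mapEdgeSet.symm).lintegral_comp hm]
  refine lintegral_congr fun y => ?_
  have hy : MeasurableEquiv.piCongrLeft (fun _ => ℝ) f.mapEdgeSet.symm y =
      fun e => y (f.mapEdgeSet e) := by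
    ext e
    have := Equiv.piCongrLeft_apply_apply (fun _ => ℝ) f.mapEdgeSet.symm y (f.mapEdgeSet e)
    rwa [Equiv.symm_apply_apply] at this
  rw [← Phi_comp hG hvw (fun e => Real.exp_pos (y e)) f hf, hy]

end Regularity

section Entropy

variable {α : Type*} [MeasurableSpace α] {P Q : Measure α}

lemma integrable_logRN [IsProbabilityMeasure P] [IsProbabilityMeasure Q] {C C' : NNReal}
    (hQP : Q ≤ C • P) (hPQ : P ≤ C' • Q) : Integrable (logRN Q P) Q := by
  have hac : Q ≪ P := (Measure.absolutelyContinuous_of_le hQP).trans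
    Measure.smul_absolutelyContinuous
  have hr : Measurable (Q.rnDeriv P) := Measure.measurable_rnDeriv Q P
  have h1 : ∀ᵐ x ∂P, Q.rnDeriv P x ≤ C := by
    refine ae_le_of_forall_setLIntegral_le_of_sigmaFinite hr fun s hs _ => ?_
    rw [Measure.setLIntegral_rnDeriv hac, setLIntegral_const]
    exact hQP s
  have h2 : ∀ᵐ x ∂P, 1 ≤ C' * Q.rnDeriv P x := by
    refine ae_le_of_forall_setLIntegral_le_of_sigmaFinite measurable_const fun s hs _ => ?_
    rw [lintegral_const_mul _ hr, Measure.setLIntegral_rnDeriv hac, setLIntegral_const, one_mul]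
    exact hPQ s
  refine Integrable.of_bound (C := max (Real.log C) (Real.log C'))
    hr.ennreal_toReal.log.aestronglyMeasurable ?_
  filter_upwards [hac h1, hac h2] with x hx1 hx2
  lift Q.rnDeriv P x to NNReal using ne_top_of_le_ne_top ENNReal.coe_ne_top hx1 with r hr'
  have hx1 : (r : ℝ) ≤ C := by exact_mod_cast hx1
  have hx2 : 1 ≤ (C' * r : ℝ) := by exact_mod_cast hx2
  have hr0 : (0 : ℝ) < r := r.coe_nonneg.lt_of_ne fun h => by simp [← h] at hx2; linarith
  have hC0 : (0 : ℝ) < C' := C'.coe_nonneg.lt_of_ne fun h => by simp [← h] at hx2; linarith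
  rw [logRN, ← hr', ENNReal.coe_toReal, Real.norm_eq_abs, abs_le']
  refine ⟨(Real.log_le_log hr0 hx1).trans (le_max_left _ _), le_max_of_le_right ?_⟩
  have := Real.log_nonneg hx2
  rw [Real.log_mul hC0.ne' hr0.ne'] at this
  linarith

lemma log_le_integral_add_integral_logRN [IsProbabilityMeasure P] [IsProbabilityMeasure Q]
    (hac : Q ≪ P) {h : α → ℝ} (hm : Measurable h) (hh : Integrable h Q)
    (hlog : Integrable (logRN Q P) Q) {c : ℝ} (hc : 0 < c)
    (hP : ∫⁻ x, ENNReal.ofReal (c * Real.exp (-h x)) ∂P ≤ 1) :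
    Real.log c ≤ ∫ x, h x ∂Q + ∫ x, logRN Q P x ∂Q := by
  have hr : Measurable (Q.rnDeriv P) := Measure.measurable_rnDeriv Q P
  set w : α → ℝ := fun x => c * Real.exp (-h x) / (Q.rnDeriv P x).toReal with hw
  have hwm : Measurable w := by fun_prop
  have hw0 : ∀ x, 0 ≤ w x := fun x => by positivity
  have hlin : ∫⁻ x, ENNReal.ofReal (w x) ∂Q ≤ 1 := by
    rw [← lintegral_rnDeriv_mul hac (by fun_prop)]
    refine (lintegral_mono_ae ?_).trans hP
    filter_upwards [Measure.rnDeriv_lt_top Q P] with x hx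
    nth_rw 1 [← ENNReal.ofReal_toReal hx.ne]
    rw [← ENNReal.ofReal_mul ENNReal.toReal_nonneg]
    refine ENNReal.ofReal_le_ofReal ?_
    obtain h0 | h0 := eq_or_ne (Q.rnDeriv P x).toReal 0
    · rw [h0, zero_mul]; positivity
    · rw [hw, mul_div_cancel₀ _ h0]
  have hwi : Integrable w Q := by
    refine ⟨hwm.aestronglyMeasurable, ?_⟩
    rw [hasFiniteIntegral_iff_ofReal (.of_forall hw0)]
    exact hlin.trans_lt ENNReal.one_lt_top
  have hw1 : ∫ x, w x ∂Q ≤ 1 := by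
    rw [integral_eq_lintegral_of_nonneg_ae (.of_forall hw0) hwm.aestronglyMeasurable]
    exact ENNReal.toReal_le_of_le_ofReal zero_le_one (by simpa using hlin)
  have key : ∫ x, (Real.log c - (h x + logRN Q P x)) ∂Q ≤ ∫ x, (w x - 1) ∂Q := by
    refine integral_mono_ae ((integrable_const _).sub (hh.add hlog))
      (hwi.sub (integrable_const _)) ?_
    filter_upwards [Measure.rnDeriv_pos hac, hac (Measure.rnDeriv_lt_top Q P)] with x hx hx'
    have hpos := ENNReal.toReal_pos hx.ne' hx'.ne
    have := Real.log_le_sub_one_of_pos (x := w x) (by positivity)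
    rw [hw, Real.log_div (by positivity) hpos.ne', Real.log_mul hc.ne' (Real.exp_pos _).ne',
      Real.log_exp] at this
    simp only [logRN, hw]
    linarith
  rw [integral_sub (g := fun x => h x + logRN Q P x) (integrable_const _) (hh.add hlog),
    integral_add hh hlog, integral_sub hwi (integrable_const _)] at key
  simp only [integral_const, probReal_univ, one_smul] at key
  linarith

variable {ρ : Measure α} {T : α → α} {D : α → ℝ≥0∞} {C : NNReal}

lemma map_withDensity_le (hT : MeasurePreserving T ρ ρ) (hD : Measurable D)
    (h : ∀ᵐ x ∂ρ, D x ≤ C * D (T x)) :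
    (ρ.withDensity D).map T ≤ C • ρ.withDensity D := by
  refine Measure.le_iff.2 fun s hs => ?_
  rw [Measure.map_apply hT.measurable hs, withDensity_apply _ (hT.measurable hs),
    Measure.smul_apply, withDensity_apply _ hs, ← hT.setLIntegral_comp_preimage hs hD,
    ENNReal.smul_def, smul_eq_mul,
    ← lintegral_const_mul (f := fun x => D (T x)) _ (hD.comp hT.measurable)]
  exact lintegral_mono_ae (ae_restrict_of_ae h)

lemma withDensity_le_map (hT : MeasurePreserving T ρ ρ) (hD : Measurable D)
    (h : ∀ᵐ x ∂ρ, D (T x) ≤ C * D x) :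
    ρ.withDensity D ≤ C • (ρ.withDensity D).map T := by
  refine Measure.le_iff.2 fun s hs => ?_
  rw [Measure.smul_apply, Measure.map_apply hT.measurable hs,
    withDensity_apply _ (hT.measurable hs), withDensity_apply _ hs,
    ← hT.setLIntegral_comp_preimage hs hD, ENNReal.smul_def, smul_eq_mul,
    ← lintegral_const_mul _ hD]
  exact lintegral_mono_ae (ae_restrict_of_ae h)

end Entropy

section InterpolatedMeasure

variable {V : Type*} [Fintype V] [DecidableEq V] {G : SimpleGraph V} [Fintype G.edgeSet]
  {a φ : Sym2 V → ℝ} {v w : V} {e₀ : G.edgeSet}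

lemma exists_interpDens_le (hG : G.Connected) (hvw : v ≠ w) (a : Sym2 V → ℝ)
    (e₀ : G.edgeSet) (K : ℝ) :
    ∃ C : NNReal, ∀ x y : G.edgeSet → ℝ, (∀ e, 0 < x e) → (∀ e, 0 < y e) →
      (∀ e, x e ≤ K * y e) → (∀ e, y e ≤ K * x e) →
        interpDens G a v w e₀ x ≤ C * interpDens G a v w e₀ y := by
  have h (u : V) : ∃ C : NNReal, ∀ x y : G.edgeSet → ℝ, (∀ e, 0 < x e) → (∀ e, 0 < y e) →
      (∀ e, x e ≤ K * y e) → (∀ e, y e ≤ K * x e) →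
        ENNReal.ofReal (Phi G a u x) ≤ C * ENNReal.ofReal (Phi G a u y) := by
    obtain ⟨C, hC, h⟩ := (tame_Phi hG hvw a u).2 K
    refine ⟨C.toNNReal, fun x y hx hy h1 h2 => ?_⟩
    exact (ENNReal.ofReal_le_ofReal (h x y hx hy h1 h2)).trans_eq (ENNReal.ofReal_mul hC.le)
  obtain ⟨C, hC⟩ := h v
  obtain ⟨C', hC'⟩ := h w
  refine ⟨(C * C') ^ (1 / 2 : ℝ), fun x y hx hy h1 h2 => ?_⟩
  rw [ENNReal.coe_rpow_of_nonneg _ (by norm_num), interpDens, interpDens,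
    ← ENNReal.mul_rpow_of_nonneg _ _ (by norm_num : (0 : ℝ) ≤ 1 / 2)]
  refine ENNReal.rpow_le_rpow ?_ (by norm_num)
  calc _ ≤ (C * ENNReal.ofReal (Phi G a v y)) / z G a v e₀ *
        ((C' * ENNReal.ofReal (Phi G a w y)) / z G a w e₀) := by
        gcongr
        · exact hC x y hx hy h1 h2
        · exact hC' x y hx hy h1 h2
    _ = _ := by
        simp only [div_eq_mul_inv, ENNReal.coe_mul]
        ring

lemma interpDens_eq (hG : G.Connected) (hvw : v ≠ w) (hz : z G a w e₀ = z G a v e₀)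
    {x : G.edgeSet → ℝ} (hx : ∀ e, 0 < x e) :
    interpDens G a v w e₀ x = ENNReal.ofReal (Phi G a v x) / z G a v e₀ *
      ENNReal.ofReal (Real.exp (Hfun G v w x)) := by
  rw [interpDens, hz, Phi_eq_Phi_mul_exp hG hvw hx a, ENNReal.ofReal_mul (Phi_pos hG hvw hx a v).le,
    two_mul, Real.exp_add, ENNReal.ofReal_mul (Real.exp_pos _).le]
  set E := ENNReal.ofReal (Real.exp (Hfun G v w x))
  set F := ENNReal.ofReal (Phi G a v x)
  have : F / z G a v e₀ * (F * (E * E) / z G a v e₀) = (F / z G a v e₀ * E) ^ (2 : ℝ) := by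
    rw [ENNReal.rpow_two, div_eq_mul_inv, div_eq_mul_inv]
    ring
  rw [this, ← ENNReal.rpow_mul]
  norm_num

lemma interpDens_mul_exp_neg (hG : G.Connected) (hvw : v ≠ w) (hz : z G a w e₀ = z G a v e₀)
    {x : G.edgeSet → ℝ} (hx : ∀ e, 0 < x e) :
    interpDens G a v w e₀ x * ENNReal.ofReal (Real.exp (-Hfun G v w x)) =
      ENNReal.ofReal (Phi G a v x) / z G a v e₀ := by
  rw [interpDens_eq hG hvw hz hx, mul_assoc, ← ENNReal.ofReal_mul (Real.exp_pos _).le,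
    ← Real.exp_add]
  simp

lemma interpDens_mul_one_add_abs_le (hG : G.Connected) (hvw : v ≠ w)
    (hz : z G a w e₀ = z G a v e₀) {x : G.edgeSet → ℝ} (hx : ∀ e, 0 < x e) :
    interpDens G a v w e₀ x * ENNReal.ofReal (1 + |Hfun G v w x|) ≤
      ENNReal.ofReal (Phi G a v x) / z G a v e₀ + ENNReal.ofReal (Phi G a w x) / z G a w e₀ := by
  have hF := (Phi_pos hG hvw hx a v).le
  rw [interpDens_eq hG hvw hz hx, hz, Phi_eq_Phi_mul_exp hG hvw hx a, ENNReal.div_add_div_same,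
    ← ENNReal.ofReal_add hF (by positivity), div_eq_mul_inv, div_eq_mul_inv, mul_assoc,
    mul_right_comm, ← ENNReal.ofReal_mul (Real.exp_pos _).le, ← ENNReal.ofReal_mul hF]
  gcongr
  rw [← mul_one_add]
  gcongr
  set h := Hfun G v w x
  have h1 : 1 + |h| ≤ Real.exp h + Real.exp (-h) := by
    obtain h0 | h0 := abs_cases h
    · linarith [Real.add_one_le_exp h, Real.exp_pos (-h)]
    · linarith [Real.add_one_le_exp (-h), Real.exp_pos h]
  calc Real.exp h * (1 + |h|) ≤ Real.exp h * (Real.exp h + Real.exp (-h)) := by gcongr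
    _ = 1 + Real.exp (2 * h) := by
      rw [mul_add, ← Real.exp_add, ← Real.exp_add]
      ring_nf
      simp [add_comm]

lemma z_ne_zero (hG : G.Connected) (hvw : v ≠ w) (u : V) : z G a u e₀ ≠ 0 := by
  rw [z, Ne, lintegral_eq_zero_iff (by fun_prop)]
  intro h
  have : (MeasureTheory.ae (rho G e₀)).NeBot := ae_neBot.2 (rho_ne_zero e₀)
  obtain ⟨x, h0, hx⟩ := (h.and (ae_rho_pos e₀)).exists
  exact (ENNReal.ofReal_pos.2 (Phi_pos hG hvw hx a u)).ne' h0

lemma lintegral_Phi_div_z (hG : G.Connected) (hvw : v ≠ w) {u : V} (hz : z G a u e₀ ≠ ⊤) :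
    ∫⁻ x, ENNReal.ofReal (Phi G a u x) / z G a u e₀ ∂rho G e₀ = 1 := by
  simp only [div_eq_mul_inv]
  rw [lintegral_mul_const _ (by fun_prop)]
  exact ENNReal.mul_inv_cancel (z_ne_zero hG hvw u) hz

lemma Zc_ne_zero (hG : G.Connected) (hvw : v ≠ w) (hz : z G a w e₀ = z G a v e₀)
    (hz0 : z G a v e₀ ≠ ⊤) : Zc G a v w e₀ ≠ 0 := by
  rw [Zc, Ne, lintegral_eq_zero_iff (by fun_prop)]
  intro h
  have : (MeasureTheory.ae (rho G e₀)).NeBot := ae_neBot.2 (rho_ne_zero e₀)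
  obtain ⟨x, h0, hx⟩ := (h.and (ae_rho_pos e₀)).exists
  have := interpDens_mul_exp_neg hG hvw hz hx
  rw [h0, Pi.zero_apply, zero_mul] at this
  exact (ENNReal.div_pos (ENNReal.ofReal_pos.2 (Phi_pos hG hvw hx a v)).ne' hz0).ne this

lemma lintegral_interpDens_mul_one_add_abs_le (hG : G.Connected) (hvw : v ≠ w)
    (hz : z G a w e₀ = z G a v e₀) (hz0 : z G a v e₀ ≠ ⊤) :
    ∫⁻ x, interpDens G a v w e₀ x * ENNReal.ofReal (1 + |Hfun G v w x|) ∂rho G e₀ ≤ 2 := by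
  refine (lintegral_mono_ae ((ae_rho_pos e₀).mono fun x hx =>
    interpDens_mul_one_add_abs_le hG hvw hz hx)).trans ?_
  rw [lintegral_add_left (by fun_prop), lintegral_Phi_div_z hG hvw hz0,
    lintegral_Phi_div_z hG hvw (hz ▸ hz0), one_add_one_eq_two]

lemma Zc_ne_top (hG : G.Connected) (hvw : v ≠ w) (hz : z G a w e₀ = z G a v e₀)
    (hz0 : z G a v e₀ ≠ ⊤) : Zc G a v w e₀ ≠ ⊤ := by
  refine ne_top_of_le_ne_top ENNReal.ofNat_ne_top
    (le_trans ?_ (lintegral_interpDens_mul_one_add_abs_le hG hvw hz hz0))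
  refine lintegral_mono fun x => le_mul_of_one_le_right' ?_
  rw [ENNReal.one_le_ofReal]
  linarith [abs_nonneg (Hfun G v w x)]

lemma isProbabilityMeasure_Pm (hG : G.Connected) (hvw : v ≠ w)
    (hz : z G a w e₀ = z G a v e₀) (hz0 : z G a v e₀ ≠ ⊤) :
    IsProbabilityMeasure (Pm G a v w e₀) := by
  refine ⟨?_⟩
  rw [Pm, Measure.smul_apply, withDensity_apply _ .univ, Measure.restrict_univ, smul_eq_mul]
  exact ENNReal.inv_mul_cancel (Zc_ne_zero hG hvw hz hz0) (Zc_ne_top hG hvw hz hz0)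

lemma lintegral_Pm {F : (G.edgeSet → ℝ) → ℝ≥0∞} (hF : Measurable F) :
    ∫⁻ x, F x ∂Pm G a v w e₀ =
      (Zc G a v w e₀)⁻¹ * ∫⁻ x, interpDens G a v w e₀ x * F x ∂rho G e₀ := by
  rw [Pm, lintegral_smul_measure, lintegral_withDensity_eq_lintegral_mul _ (by fun_prop) hF,
    smul_eq_mul]
  rfl

lemma integrable_Hfun_Pm (hG : G.Connected) (hvw : v ≠ w) (hz : z G a w e₀ = z G a v e₀)
    (hz0 : z G a v e₀ ≠ ⊤) : Integrable (Hfun G v w) (Pm G a v w e₀) := by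
  refine ⟨by fun_prop, ?_⟩
  rw [hasFiniteIntegral_iff_norm, lintegral_Pm (by fun_prop)]
  refine ENNReal.mul_lt_top (ENNReal.inv_lt_top.2 (Zc_ne_zero hG hvw hz hz0).bot_lt) ?_
  refine lt_of_le_of_lt (le_trans (lintegral_mono fun x => ?_)
    (lintegral_interpDens_mul_one_add_abs_le hG hvw hz hz0)) ENNReal.ofNat_lt_top
  gcongr
  rw [Real.norm_eq_abs]
  linarith

lemma lintegral_exp_neg_Hfun_Pm (hG : G.Connected) (hvw : v ≠ w)
    (hz : z G a w e₀ = z G a v e₀) (hz0 : z G a v e₀ ≠ ⊤) :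
    ∫⁻ x, ENNReal.ofReal ((Zc G a v w e₀).toReal * Real.exp (-Hfun G v w x)) ∂Pm G a v w e₀ =
      1 := by
  have h : ∫⁻ x, interpDens G a v w e₀ x * ENNReal.ofReal (Real.exp (-Hfun G v w x))
      ∂rho G e₀ = 1 :=
    (lintegral_congr_ae ((ae_rho_pos e₀).mono fun x hx =>
      interpDens_mul_exp_neg hG hvw hz hx)).trans (lintegral_Phi_div_z hG hvw hz0)
  simp only [ENNReal.ofReal_mul ENNReal.toReal_nonneg,
    ENNReal.ofReal_toReal (Zc_ne_top hG hvw hz hz0)]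
  rw [lintegral_const_mul _ (by fun_prop), lintegral_Pm (by fun_prop), h, mul_one,
    ENNReal.mul_inv_cancel (Zc_ne_zero hG hvw hz hz0) (Zc_ne_top hG hvw hz hz0)]

lemma Xi_le (hφ : ∀ e : G.edgeSet, φ e ∈ Set.Icc (0 : ℝ) 1) (γ : ℝ) {x : G.edgeSet → ℝ}
    (hx : ∀ e, 0 < x e) (e : G.edgeSet) : Xi G φ γ x e ≤ Real.exp |γ| * x e := by
  refine mul_le_mul_of_nonneg_right (Real.exp_le_exp.2 ?_) (hx e).le
  nlinarith [abs_nonneg γ, le_abs_self γ, (hφ e).1, (hφ e).2]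

lemma le_Xi (hφ : ∀ e : G.edgeSet, φ e ∈ Set.Icc (0 : ℝ) 1) (γ : ℝ) {x : G.edgeSet → ℝ}
    (hx : ∀ e, 0 < x e) (e : G.edgeSet) : x e ≤ Real.exp |γ| * Xi G φ γ x e := by
  rw [Xi, ← mul_assoc, ← Real.exp_add]
  refine le_mul_of_one_le_left (hx e).le (Real.one_le_exp ?_)
  nlinarith [abs_nonneg γ, neg_abs_le γ, (hφ e).1, (hφ e).2]

lemma exists_PiGamma_le (hG : G.Connected) (hvw : v ≠ w) (a : Sym2 V → ℝ)
    (hφ : ∀ e : G.edgeSet, φ e ∈ Set.Icc (0 : ℝ) 1) (hφ₀ : φ e₀ = 0) (γ : ℝ) :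
    ∃ C : NNReal, PiGamma G a φ v w e₀ γ ≤ C • Pm G a v w e₀ ∧
      Pm G a v w e₀ ≤ C • PiGamma G a φ v w e₀ γ := by
  obtain ⟨C, hC⟩ := exists_interpDens_le hG hvw a e₀ (Real.exp |γ|)
  have hXi {x : G.edgeSet → ℝ} (hx : ∀ e, 0 < x e) (e : G.edgeSet) : 0 < Xi G φ γ x e :=
    mul_pos (Real.exp_pos _) (hx e)
  have h1 := map_withDensity_le (measurePreserving_Xi hφ₀ γ) (measurable_interpDens a v w e₀)
    ((ae_rho_pos e₀).mono fun x hx =>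
      hC x (Xi G φ γ x) hx (hXi hx) (le_Xi hφ γ hx) (Xi_le hφ γ hx))
  have h2 := withDensity_le_map (measurePreserving_Xi hφ₀ γ) (measurable_interpDens a v w e₀)
    ((ae_rho_pos e₀).mono fun x hx =>
      hC (Xi G φ γ x) x (hXi hx) hx (Xi_le hφ γ hx) (le_Xi hφ γ hx))
  refine ⟨C, ?_, ?_⟩ <;> rw [PiGamma, Pm, Measure.map_smul, smul_comm]
  · gcongr
  · gcongr

end InterpolatedMeasure

end ERRWGraph

open ERRWGraph in
/-- Lemma 5.4 (Key estimate): under Assumption 2.3, for every `γ ∈ ℝ`,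
`log Z_{v₀,v₁,e₀} ≤ E_{Π^{γφ}}[H] + E_{Π^{γφ}}[log(dΠ^{γφ}/dℙ_{v₀,v₁,e₀})]`. -/
theorem key_estimate {V : Type*} [Fintype V] [DecidableEq V]
    (G : SimpleGraph V) [Fintype G.edgeSet] (hG : G.Connected)
    (a φ : Sym2 V → ℝ) (ha : ∀ e ∈ G.edgeSet, 0 < a e)
    (v₀ v₁ : V) (e₀ : G.edgeSet)
    (hass : Assumption23 G a φ v₀ v₁ e₀)
    (hz0 : z G a v₀ e₀ ≠ ⊤) (hz1 : z G a v₁ e₀ ≠ ⊤) (γ : ℝ) :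
    Real.log (Zc G a v₀ v₁ e₀).toReal ≤
      (∫ x, Hfun G v₀ v₁ x ∂PiGamma G a φ v₀ v₁ e₀ γ) +
        ∫ x, logRN (PiGamma G a φ v₀ v₁ e₀ γ) (Pm G a v₀ v₁ e₀) x
          ∂PiGamma G a φ v₀ v₁ e₀ γ := by
  obtain ⟨hv, -, he₀, ⟨f, hf, hf₀, -⟩, hφ, hφ₀, -⟩ := hass
  obtain ⟨g, hg, hga⟩ := hf.exists_iso
  have hz : z G a v₁ e₀ = z G a v₀ e₀ := by
    rw [← hf₀, ← hg]
    exact z_eq_z_of_iso hG hv g hga v₀ e₀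
  have hP := isProbabilityMeasure_Pm hG hv hz hz0
  have hQ : IsProbabilityMeasure (PiGamma G a φ v₀ v₁ e₀ γ) :=
    Measure.isProbabilityMeasure_map (measurable_Xi φ γ).aemeasurable
  obtain ⟨C, hQP, hPQ⟩ := exists_PiGamma_le hG hv a hφ (hφ₀ e₀ he₀) γ
  refine log_le_integral_add_integral_logRN
    ((Measure.absolutelyContinuous_of_le hQP).trans Measure.smul_absolutelyContinuous)
    (measurable_Hfun v₀ v₁)
    (((integrable_Hfun_Pm hG hv hz hz0).smul_measure_nnreal).mono_measure hQP)
    (integrable_logRN hQP hPQ)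
    (ENNReal.toReal_pos (Zc_ne_zero hG hv hz hz0) (Zc_ne_top hG hv hz hz0))
    (lintegral_exp_neg_Hfun_Pm hG hv hz hz0).le
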